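/- arXiv:1701.05372 — 6 statements merged into one kernel-verified Lean document; each statement's English description precedes it below -/
import Mathlib

section
/- Let n ≥ 2 be an integer and let Γ₀ ⊆ Sym(n,ℝ) be a nonempty cone, invariant under conjugation by orthogonal matrices, whose closure Γ̄₀ satisfies: (i) every W ∈ Γ̄₀ with W ≠ 0 has tr W > 0, and (ii) the diagonal matrix diag(0,…,0,1) does not belong to Γ̄₀. Then there exists a constant γ > 0 such that for every W ∈ Γ̄₀ and every totally symmetric array T : {1,…,n}³ → ℝ one has ∑_{p,q,k,i,j=1}^n (W_{pq} T_{kij} − W_{ij} T_{kpq})² ≥ γ · (∑_{i,j=1}^n W_{ij}²) · (∑_{k,i,j=1}^n T_{kij}²). -/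
open Matrix Finset

/-- Two unit vectors are exchanged by a Householder reflection. -/
lemma exists_orthogonal_mulVec_eq {ι : Type*} [Fintype ι] [DecidableEq ι] (u e : ι → ℝ)
    (hu : u ⬝ᵥ u = 1) (he : e ⬝ᵥ e = 1) :
    ∃ U : Matrix ι ι ℝ, U * Uᵀ = 1 ∧ Uᵀ *ᵥ u = e := by
  set v := u - e with hv
  set c := 2 / (v ⬝ᵥ v) with hc
  have hvv : v ⬝ᵥ v = 2 * (v ⬝ᵥ u) := by
    simp only [hv, sub_dotProduct, dotProduct_sub, hu, he, dotProduct_comm e u]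
    ring
  have hsymm : (1 - c • vecMulVec v v)ᵀ = 1 - c • vecMulVec v v := by
    simp [transpose_vecMulVec]
  have hcc : c * c * (v ⬝ᵥ v) = 2 * c := by
    rcases eq_or_ne (v ⬝ᵥ v) 0 with h | h
    · simp [hc, h]
    · rw [hc]; field_simp
  refine ⟨1 - c • vecMulVec v v, ?_, ?_⟩
  · rw [hsymm]
    ext i j
    have h : vecMulVec v v * vecMulVec v v = (v ⬝ᵥ v) • vecMulVec v v := by
      ext i j
      simp only [vecMulVec_apply, mul_apply, Matrix.smul_apply, smul_eq_mul, dotProduct,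
        Finset.sum_mul]
      exact Finset.sum_congr rfl fun k _ => by ring
    simp only [sub_mul, mul_sub, one_mul, mul_one, smul_mul_assoc, mul_smul_comm, h, smul_smul,
      Matrix.sub_apply, Matrix.smul_apply, smul_eq_mul]
    linear_combination vecMulVec v v i j * hcc
  · rw [hsymm, sub_mulVec, one_mulVec, smul_mulVec, vecMulVec_mulVec]
    rcases eq_or_ne (v ⬝ᵥ v) 0 with h | h
    · have : v = 0 := dotProduct_self_eq_zero.mp h
      simp only [this, zero_dotProduct]
      simpa using sub_eq_zero.mp (hv.symm.trans this)
    · have h1 : c * (v ⬝ᵥ u) = 1 := by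
        rw [hc, hvv]
        rw [hvv] at h
        rw [div_mul_eq_mul_div, div_self h]
      ext i
      have h2 : v i = u i - e i := rfl
      simp only [Pi.sub_apply, Pi.smul_apply, smul_eq_mul, MulOpposite.smul_eq_mul_unop,
        MulOpposite.unop_op]
      linear_combination (-v i) * h1 - h2

lemma eq_zero_of_sum_eq_zero {ι : Type*} [Fintype ι] {f : ι → ℝ} (hf : ∀ i, 0 ≤ f i)
    (h : ∑ i, f i = 0) (i : ι) : f i = 0 :=
  (Finset.sum_eq_zero_iff_of_nonneg fun i _ => hf i).mp h i (Finset.mem_univ i)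

lemma eq_zero_of_sum_sq_eq_zero {ι : Type*} [Fintype ι] {f : ι → ℝ}
    (h : ∑ i, f i ^ 2 = 0) (i : ι) : f i = 0 :=
  (pow_eq_zero_iff two_ne_zero).mp (eq_zero_of_sum_eq_zero (fun _ => sq_nonneg _) h i)

lemma eq_zero_of_sum_sum_sq_eq_zero {ι κ : Type*} [Fintype ι] [Fintype κ] {f : ι → κ → ℝ}
    (h : ∑ i, ∑ j, f i j ^ 2 = 0) (i : ι) (j : κ) : f i j = 0 :=
  eq_zero_of_sum_sq_eq_zero
    (eq_zero_of_sum_eq_zero (fun _ => Finset.sum_nonneg fun _ _ => sq_nonneg _) h i) j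

lemma eq_zero_of_sum_sum_sum_sq_eq_zero {ι κ μ : Type*} [Fintype ι] [Fintype κ] [Fintype μ]
    {f : ι → κ → μ → ℝ} (h : ∑ i, ∑ j, ∑ k, f i j k ^ 2 = 0) (i : ι) (j : κ) (k : μ) :
    f i j k = 0 :=
  eq_zero_of_sum_sum_sq_eq_zero (eq_zero_of_sum_eq_zero
    (fun _ => Finset.sum_nonneg fun _ _ => Finset.sum_nonneg fun _ _ => sq_nonneg _) h i) j k

lemma tensor_comm_of_sum_sq_nonpos {ι : Type*} [Fintype ι] (W : ι → ι → ℝ) (T : ι → ι → ι → ℝ)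
    (h : ∑ p, ∑ q, ∑ k, ∑ i, ∑ j, (W p q * T k i j - W i j * T k p q) ^ 2 ≤ 0)
    (p q k i j : ι) : W p q * T k i j = W i j * T k p q := by
  have hnn : ∀ p q, 0 ≤ ∑ k, ∑ i, ∑ j, (W p q * T k i j - W i j * T k p q) ^ 2 := fun p q =>
    Finset.sum_nonneg fun _ _ => Finset.sum_nonneg fun _ _ => Finset.sum_nonneg fun _ _ =>
      sq_nonneg _
  have hnn' := fun p => Finset.sum_nonneg fun q (_ : q ∈ Finset.univ) => hnn p q
  have h1 := eq_zero_of_sum_eq_zero hnn' (h.antisymm (Finset.sum_nonneg fun p _ => hnn' p)) p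
  have h2 := eq_zero_of_sum_eq_zero (hnn p) h1 q
  exact sub_eq_zero.mp (eq_zero_of_sum_sum_sum_sq_eq_zero h2 k i j)

/-- If `W ⊗ T = T ⊗ W` for a symmetric matrix `W ≠ 0` and a totally symmetric array `T ≠ 0`,
then `W` has rank one. -/
lemma exists_eq_smul_vecMulVec_of_tensor_comm {ι : Type*} (W : Matrix ι ι ℝ)
    (T : ι → ι → ι → ℝ) (hW : W.IsSymm) (hW0 : W ≠ 0) (hT0 : T ≠ 0)
    (hT : ∀ i j k, T i j k = T j i k)
    (hWT : ∀ p q k i j, W p q * T k i j = W i j * T k p q) :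
    ∃ (c : ℝ) (a : ι → ℝ), a ≠ 0 ∧ W = c • vecMulVec a a := by
  obtain ⟨p, q, hpq⟩ : ∃ p q, W p q ≠ 0 := by
    by_contra! h
    exact hW0 (by ext i j; exact h i j)
  have hTa : ∀ k i j, T k i j = T k p q / W p q * W i j := fun k i j => by
    field_simp
    linarith [hWT p q k i j]
  set a : ι → ℝ := fun k => T k p q / W p q with ha
  obtain ⟨m, hm⟩ : ∃ m, a m ≠ 0 := by
    by_contra! h
    refine hT0 ?_
    ext k i j
    rw [hTa, show T k p q / W p q = 0 from h k, zero_mul]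
    rfl
  have haW : ∀ k i j, a k * W i j = a i * W k j := fun k i j => by
    have h := hT k i j
    rwa [hTa k, hTa i] at h
  refine ⟨W m m / (a m) ^ 2, a, fun h => hm (by simp [h]), ?_⟩
  ext i j
  simp only [Matrix.smul_apply, vecMulVec_apply, smul_eq_mul]
  field_simp
  have h1 := haW m i j
  have h2 := haW m j m
  rw [hW.apply m j] at h2
  linear_combination a m * h1 + a i * h2

/-- A nonzero rank one symmetric matrix of positive trace is, up to a positive factor,
orthogonally conjugate to the square of any unit vector. -/
lemma exists_orthogonal_conj_smul_eq {ι : Type*} [Fintype ι] [DecidableEq ι]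
    (c : ℝ) (a e : ι → ℝ) (ha : a ≠ 0) (he : e ⬝ᵥ e = 1)
    (htr : 0 < (c • vecMulVec a a).trace) :
    ∃ (s : ℝ) (U : Matrix ι ι ℝ), 0 < s ∧ U * Uᵀ = 1 ∧
      Uᵀ * (s • (c • vecMulVec a a)) * U = vecMulVec e e := by
  rw [trace_smul, trace_vecMulVec, smul_eq_mul] at htr
  have hS : 0 < a ⬝ᵥ a :=
    lt_of_le_of_ne (Finset.sum_nonneg fun i _ => mul_self_nonneg _)
      (fun h => ha (dotProduct_self_eq_zero.mp h.symm))
  have hr : √(a ⬝ᵥ a) * √(a ⬝ᵥ a) = a ⬝ᵥ a := Real.mul_self_sqrt hS.le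
  have hr0 : √(a ⬝ᵥ a) ≠ 0 := (Real.sqrt_pos.mpr hS).ne'
  have hc : c ≠ 0 := by rintro rfl; simp at htr
  obtain ⟨U, hU, hUe⟩ := exists_orthogonal_mulVec_eq ((√(a ⬝ᵥ a))⁻¹ • a) e
    (by
      rw [smul_dotProduct, dotProduct_smul, smul_eq_mul, smul_eq_mul, ← mul_assoc, ← mul_inv, hr]
      exact inv_mul_cancel₀ hS.ne') he
  refine ⟨(c * (a ⬝ᵥ a))⁻¹, U, inv_pos.mpr htr, hU, ?_⟩
  have h : (c * (a ⬝ᵥ a))⁻¹ • (c • vecMulVec a a)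
      = vecMulVec ((√(a ⬝ᵥ a))⁻¹ • a) ((√(a ⬝ᵥ a))⁻¹ • a) := by
    ext i j
    simp only [Matrix.smul_apply, vecMulVec_apply, smul_eq_mul, Pi.smul_apply]
    field_simp
    rw [pow_two, hr]
    ring
  rw [h, mul_vecMulVec, vecMulVec_mul, hUe, ← mulVec_transpose, hUe]

/-- A continuous function on a product of closed sets of matrices and three-index arrays, both
closed under positive scaling, that is homogeneous of degree two in each variable and positive
away from zero dominates the product of the squared norms. -/
lemma exists_pos_mul_sq_norms_le {ι : Type*} [Fintype ι]
    (A : Set (ι → ι → ℝ)) (B : Set (ι → ι → ι → ℝ)) (hA : IsClosed A) (hB : IsClosed B)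
    (hAc : ∀ c : ℝ, 0 < c → ∀ W ∈ A, c • W ∈ A)
    (hBc : ∀ c : ℝ, 0 < c → ∀ T ∈ B, c • T ∈ B)
    (F : (ι → ι → ℝ) → (ι → ι → ι → ℝ) → ℝ)
    (hF : Continuous fun x : (ι → ι → ℝ) × (ι → ι → ι → ℝ) => F x.1 x.2)
    (hFc : ∀ (s t : ℝ) W T, F (s • W) (t • T) = s ^ 2 * t ^ 2 * F W T)
    (hFpos : ∀ W ∈ A, ∀ T ∈ B, W ≠ 0 → T ≠ 0 → 0 < F W T) :
    ∃ γ : ℝ, 0 < γ ∧ ∀ W ∈ A, ∀ T ∈ B,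
      γ * ((∑ i, ∑ j, (W i j) ^ 2) * (∑ k, ∑ i, ∑ j, (T k i j) ^ 2)) ≤ F W T := by
  set K : Set ((ι → ι → ℝ) × (ι → ι → ι → ℝ)) :=
    {x | x.1 ∈ A ∧ x.2 ∈ B ∧ ∑ i, ∑ j, (x.1 i j) ^ 2 = 1 ∧
      ∑ k, ∑ i, ∑ j, (x.2 k i j) ^ 2 = 1} with hK
  have hKclosed : IsClosed K :=
    (hA.preimage continuous_fst).inter <| (hB.preimage continuous_snd).inter <|
      (isClosed_eq (by fun_prop) continuous_const).inter
        (isClosed_eq (by fun_prop) continuous_const)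
  have hbox : IsCompact
      ((Set.univ.pi fun _ : ι => Set.univ.pi fun _ : ι => Set.Icc (-1 : ℝ) 1) ×ˢ
        (Set.univ.pi fun _ : ι => Set.univ.pi fun _ : ι => Set.univ.pi fun _ : ι =>
          Set.Icc (-1 : ℝ) 1)) :=
    (isCompact_univ_pi fun _ => isCompact_univ_pi fun _ => isCompact_Icc).prod
      (isCompact_univ_pi fun _ => isCompact_univ_pi fun _ => isCompact_univ_pi fun _ =>
        isCompact_Icc)
  have hKcompact : IsCompact K := by
    refine hbox.of_isClosed_subset hKclosed ?_
    rintro ⟨W, T⟩ ⟨-, -, hW, hT⟩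
    refine ⟨fun i _ j _ => abs_le.mp ((sq_le_one_iff_abs_le_one _).mp ?_),
      fun k _ i _ j _ => abs_le.mp ((sq_le_one_iff_abs_le_one _).mp ?_)⟩
    · calc W i j ^ 2 ≤ ∑ j, W i j ^ 2 :=
            Finset.single_le_sum (f := fun j => W i j ^ 2) (fun _ _ => by positivity)
              (Finset.mem_univ j)
        _ ≤ ∑ i, ∑ j, W i j ^ 2 :=
            Finset.single_le_sum (f := fun i => ∑ j, W i j ^ 2) (fun _ _ => by positivity)
              (Finset.mem_univ i)
        _ = 1 := hW
    · calc T k i j ^ 2 ≤ ∑ j, T k i j ^ 2 :=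
            Finset.single_le_sum (f := fun j => T k i j ^ 2) (fun _ _ => by positivity)
              (Finset.mem_univ j)
        _ ≤ ∑ i, ∑ j, T k i j ^ 2 :=
            Finset.single_le_sum (f := fun i => ∑ j, T k i j ^ 2) (fun _ _ => by positivity)
              (Finset.mem_univ i)
        _ ≤ ∑ k, ∑ i, ∑ j, T k i j ^ 2 :=
            Finset.single_le_sum (f := fun k => ∑ i, ∑ j, T k i j ^ 2)
              (fun _ _ => by positivity) (Finset.mem_univ k)
        _ = 1 := hT
  obtain ⟨γ, hγ, hmin⟩ : ∃ γ : ℝ, 0 < γ ∧ ∀ x ∈ K, γ ≤ F x.1 x.2 := by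
    rcases K.eq_empty_or_nonempty with h | h
    · exact ⟨1, one_pos, by simp [h]⟩
    · obtain ⟨x, hx, hxmin⟩ := hKcompact.exists_isMinOn h hF.continuousOn
      refine ⟨F x.1 x.2, hFpos _ hx.1 _ hx.2.1 ?_ ?_, fun y hy => hxmin hy⟩
      · intro h0
        simpa [h0] using hx.2.2.1
      · intro h0
        simpa [h0] using hx.2.2.2
  refine ⟨γ, hγ, fun W hW T hT => ?_⟩
  set a := ∑ i, ∑ j, (W i j) ^ 2 with ha
  set b := ∑ k, ∑ i, ∑ j, (T k i j) ^ 2 with hb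
  have ha0 : 0 ≤ a := Finset.sum_nonneg fun _ _ => Finset.sum_nonneg fun _ _ => sq_nonneg _
  have hb0 : 0 ≤ b := Finset.sum_nonneg fun _ _ => Finset.sum_nonneg fun _ _ =>
    Finset.sum_nonneg fun _ _ => sq_nonneg _
  have hFzero : a = 0 ∨ b = 0 → 0 ≤ F W T := by
    rintro (h | h)
    · have hW0 : W = 0 := by
        ext i j
        exact eq_zero_of_sum_sum_sq_eq_zero h i j
      have := hFc 0 1 W T
      rw [zero_smul, one_smul] at this
      rw [hW0, this]; simp
    · have hT0 : T = 0 := by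
        ext k i j
        exact eq_zero_of_sum_sum_sum_sq_eq_zero h k i j
      have := hFc 1 0 W T
      rw [zero_smul, one_smul] at this
      rw [hT0, this]; simp
  rcases ha0.eq_or_lt with h | hapos
  · simpa [← h] using hFzero (.inl h.symm)
  rcases hb0.eq_or_lt with h | hbpos
  · simpa [← h] using hFzero (.inr h.symm)
  have hsa : ((√a)⁻¹) ^ 2 = a⁻¹ := by rw [inv_pow, Real.sq_sqrt ha0]
  have hsb : ((√b)⁻¹) ^ 2 = b⁻¹ := by rw [inv_pow, Real.sq_sqrt hb0]
  have hmem : ((√a)⁻¹ • W, (√b)⁻¹ • T) ∈ K := by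
    refine ⟨hAc _ (inv_pos.mpr (Real.sqrt_pos.mpr hapos)) W hW, hBc _ (inv_pos.mpr (Real.sqrt_pos.mpr hbpos)) T hT, ?_, ?_⟩
    · simp only [Pi.smul_apply, smul_eq_mul, mul_pow, hsa, ← Finset.mul_sum]
      exact inv_mul_cancel₀ hapos.ne'
    · simp only [Pi.smul_apply, smul_eq_mul, mul_pow, hsb, ← Finset.mul_sum]
      exact inv_mul_cancel₀ hbpos.ne'
  have h := hmin _ hmem
  rw [hFc, hsa, hsb, ← mul_inv, inv_mul_eq_div, le_div_iff₀ (mul_pos hapos hbpos)] at h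
  exact h

/-- pointwise algebraic form of the gradient estimate, Lemma 2.1:
For a nonempty `O(n)`-invariant cone `Γ₀` of symmetric matrices whose closure consists of
matrices of positive trace (away from `0`) and avoids the cylindrical point
`diag(0,…,0,1)`, there is `γ > 0` such that for all `W` in the closure and all totally
symmetric three-index arrays `T`,
`∑ (W_{pq} T_{kij} − W_{ij} T_{kpq})² ≥ γ ‖W‖² ‖T‖²`. -/
theorem stmt_0 (n : ℕ) (hn : 2 ≤ n)
    (Γ₀ : Set (Matrix (Fin n) (Fin n) ℝ))
    (hne : Γ₀.Nonempty)
    (hsym : ∀ W ∈ Γ₀, W.IsSymm)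
    (hcone : ∀ (c : ℝ), 0 < c → ∀ W ∈ Γ₀, c • W ∈ Γ₀)
    (hOn : ∀ U : Matrix (Fin n) (Fin n) ℝ, U * Uᵀ = 1 → ∀ W ∈ Γ₀, Uᵀ * W * U ∈ Γ₀)
    (htrace : ∀ W ∈ closure Γ₀, W ≠ 0 → 0 < W.trace)
    (hcyl : (Matrix.diagonal (fun i : Fin n => if (i : ℕ) = n - 1 then (1 : ℝ) else 0))
        ∉ closure Γ₀) :
    ∃ γ : ℝ, 0 < γ ∧ ∀ W ∈ closure Γ₀, ∀ T : Fin n → Fin n → Fin n → ℝ,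
      (∀ i j k, T i j k = T j i k) → (∀ i j k, T i j k = T i k j) →
      γ * ((∑ i, ∑ j, (W i j) ^ 2) * (∑ k, ∑ i, ∑ j, (T k i j) ^ 2)) ≤
        ∑ p, ∑ q, ∑ k, ∑ i, ∑ j, (W p q * T k i j - W i j * T k p q) ^ 2 := by
  have hsymm : ∀ W ∈ closure Γ₀, W.IsSymm :=
    closure_minimal hsym (isClosed_eq (by fun_prop) continuous_id)
  have hsmul : ∀ c : ℝ, 0 < c → ∀ W ∈ closure Γ₀, c • W ∈ closure Γ₀ := fun c hc W hW =>
    map_mem_closure (continuous_const_smul c) hW (hcone c hc)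
  have hconj : ∀ U : Matrix (Fin n) (Fin n) ℝ, U * Uᵀ = 1 →
      ∀ W ∈ closure Γ₀, Uᵀ * W * U ∈ closure Γ₀ := fun U hU W hW =>
    map_mem_closure (f := fun W => Uᵀ * W * U) (by fun_prop) hW (hOn U hU)
  have hmain := exists_pos_mul_sq_norms_le (closure Γ₀)
    {T : Fin n → Fin n → Fin n → ℝ |
      (∀ i j k, T i j k = T j i k) ∧ ∀ i j k, T i j k = T i k j}
    isClosed_closure ?_ hsmul ?_
    (fun W T => ∑ p, ∑ q, ∑ k, ∑ i, ∑ j, (W p q * T k i j - W i j * T k p q) ^ 2)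
    (by fun_prop) ?_ ?_
  · obtain ⟨γ, hγ, h⟩ := hmain
    exact ⟨γ, hγ, fun W hW T h1 h2 => h W hW T ⟨h1, h2⟩⟩
  · simp only [Set.ofPred_and, Set.ofPred_forall]
    refine IsClosed.inter ?_ ?_ <;>
    exact isClosed_iInter fun i => isClosed_iInter fun j => isClosed_iInter fun k =>
      isClosed_eq (by fun_prop) (by fun_prop)
  · rintro c - T ⟨h1, h2⟩
    exact ⟨fun i j k => by simp [h1 i j k], fun i j k => by simp [h2 i j k]⟩
  · intro s t W T
    simp only [Finset.mul_sum, Pi.smul_apply, smul_eq_mul]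
    refine Finset.sum_congr rfl fun p _ => Finset.sum_congr rfl fun q _ =>
      Finset.sum_congr rfl fun k _ => Finset.sum_congr rfl fun i _ =>
      Finset.sum_congr rfl fun j _ => by ring
  · intro W hW T hT hW0 hT0
    by_contra h0
    refine hcyl ?_
    have hWT := tensor_comm_of_sum_sq_nonpos W T (not_lt.mp h0)
    obtain ⟨c, a, ha, hWa⟩ :=
      exists_eq_smul_vecMulVec_of_tensor_comm W T (hsymm W hW) hW0 hT0 hT.1 hWT
    have htr : 0 < Matrix.trace W := htrace W hW hW0
    rw [hWa] at htr
    set l : Fin n := ⟨n - 1, by omega⟩ with hl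
    obtain ⟨s, U, hs, hU, hUe⟩ :=
      exists_orthogonal_conj_smul_eq c a (Pi.single l 1) ha (by simp) htr
    have hmem := hconj U hU _ (hsmul s hs W hW)
    rw [hWa, hUe] at hmem
    convert hmem using 1
    ext i j
    have hil : (i : ℕ) = n - 1 ↔ i = l := by rw [hl, Fin.ext_iff]
    simp only [diagonal_apply, vecMulVec_apply, Pi.single_apply, hil]
    by_cases hij : i = j
    · subst hij; simp
    · by_cases hi : i = l
      · subst hi; simp [hij, Ne.symm hij]
      · simp [hij, hi]
end

section
/- Let n ≥ 1 and let A be a real symmetric n×n matrix with eigenvalues κ_1,…,κ_n listed with multiplicity. Define the four-index array C by C_{ijkl} := A_{ij}(A²)_{kl} − (A²)_{ij}A_{kl}. Then ∑_{i,j,k,l=1}^n C_{ijkl}² = 2 ∑_{1≤i<j≤n} κ_i² κ_j² (κ_i − κ_j)². -/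
open Matrix Finset

/-- Lagrange's identity for the full double sum. -/
theorem sum_sum_mul_sub_mul_sq {ι R : Type*} [Fintype ι] [CommRing R] (f g : ι → R) :
    ∑ x, ∑ y, (f x * g y - g x * f y) ^ 2
      = 2 * ((∑ x, f x * f x) * (∑ x, g x * g x) - (∑ x, f x * g x) ^ 2) := by
  have expand : ∀ x y, (f x * g y - g x * f y) ^ 2
      = (f x * f x) * (g y * g y) + (g x * g x) * (f y * f y)
        - 2 * ((f x * g x) * (f y * g y)) := fun x y => by ring
  simp only [expand, sum_sub_distrib, sum_add_distrib, ← mul_sum, ← sum_mul]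
  ring

/-- The Frobenius inner product of two matrices that are simultaneously orthogonally
diagonalized is the inner product of their eigenvalues. -/
theorem sum_mul_of_orthogonal_diagonalization {m R : Type*} [Fintype m] [DecidableEq m]
    [CommRing R] {U : Matrix m m R} (hU : U * Uᵀ = 1) (a b : m → R) :
    ∑ p : m × m, (U * diagonal a * Uᵀ) p.1 p.2 * (U * diagonal b * Uᵀ) p.1 p.2
      = ∑ i, a i * b i := by
  have hU' : Uᵀ * U = 1 := mul_eq_one_comm.mp hU
  have trace_form : ∀ M N : Matrix m m R, ∑ p : m × m, M p.1 p.2 * N p.1 p.2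
      = (M * Nᵀ).trace := fun M N => by
    simp [Fintype.sum_prod_type, trace, mul_apply]
  have product : (U * diagonal a * Uᵀ) * (U * diagonal b * Uᵀ)ᵀ
      = U * (diagonal a * diagonal b * Uᵀ) := by
    simp only [transpose_mul, transpose_transpose, diagonal_transpose, Matrix.mul_assoc]
    rw [← Matrix.mul_assoc Uᵀ U, hU', Matrix.one_mul]
  rw [trace_form, product, trace_mul_comm, Matrix.mul_assoc, hU', Matrix.mul_one,
    diagonal_mul_diagonal, trace_diagonal]

/-- The double sum of a symmetric function vanishing on the diagonal is twice its sum over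
the pairs `i < j`. -/
theorem sum_sum_eq_two_mul_sum_lt {ι R : Type*} [Fintype ι] [LinearOrder ι] [CommRing R]
    (f : ι → ι → R) (hsymm : ∀ i j, f i j = f j i) (hdiag : ∀ i, f i i = 0) :
    ∑ i, ∑ j, f i j = 2 * ∑ p ∈ univ.filter (fun p : ι × ι => p.1 < p.2), f p.1 p.2 := by
  have split : ∀ i j, f i j = (if i < j then f i j else 0) + (if j < i then f j i else 0) := by
    intro i j
    rcases lt_trichotomy i j with h | rfl | h
    · simp [h, h.not_gt]
    · simp [hdiag]
    · simp [h, h.not_gt, hsymm i j]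
  rw [sum_filter, Fintype.sum_prod_type, two_mul]
  conv_lhs => enter [2, i, 2, j]; rw [split i j]
  simp only [sum_add_distrib]
  congr 1
  exact sum_comm

/-- norm identity for `C = A⊗A² − A²⊗A`, from the proof of
Proposition 2.4: if `A` is a real symmetric matrix with eigenvalues `κ` (listed with
multiplicity, i.e. `A = U (diag κ) Uᵀ` for an orthogonal `U`), and
`C_{ijkl} = A_{ij}(A²)_{kl} − (A²)_{ij}A_{kl}`, then
`∑ C_{ijkl}² = 2 ∑_{i<j} κ_i² κ_j² (κ_i − κ_j)²`. -/
theorem stmt_2 (n : ℕ) (hn : 1 ≤ n)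
    (A U : Matrix (Fin n) (Fin n) ℝ) (κ : Fin n → ℝ)
    (hU : U * Uᵀ = 1)
    (hA : A = U * Matrix.diagonal κ * Uᵀ) :
    ∑ i, ∑ j, ∑ k, ∑ l, (A i j * (A * A) k l - (A * A) i j * A k l) ^ 2
      = 2 * ∑ p ∈ Finset.univ.filter (fun p : Fin n × Fin n => p.1 < p.2),
          (κ p.1) ^ 2 * (κ p.2) ^ 2 * (κ p.1 - κ p.2) ^ 2 := by
  have hU' : Uᵀ * U = 1 := mul_eq_one_comm.mp hU
  have hAA : A * A = U * diagonal (fun i => κ i ^ 2) * Uᵀ := by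
    have hsq : diagonal (fun i => κ i ^ 2) = diagonal κ * diagonal κ := by
      simp [diagonal_mul_diagonal, sq]
    rw [hA, hsq]
    simp only [Matrix.mul_assoc]
    rw [← Matrix.mul_assoc Uᵀ U, hU', Matrix.one_mul]
  have key : ∑ i, ∑ j, ∑ k, ∑ l, (A i j * (A * A) k l - (A * A) i j * A k l) ^ 2
      = ∑ i, ∑ j, (κ i * κ j ^ 2 - κ i ^ 2 * κ j) ^ 2 := by
    have hmat := sum_sum_mul_sub_mul_sq (fun p : Fin n × Fin n => A p.1 p.2)
      (fun p => (A * A) p.1 p.2)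
    rw [hAA, hA] at hmat
    simp only [sum_mul_of_orthogonal_diagonalization hU] at hmat
    rw [sum_sum_mul_sub_mul_sq κ (fun i => κ i ^ 2), ← hmat, hAA, hA]
    simp only [Fintype.sum_prod_type]
  rw [key, sum_sum_eq_two_mul_sum_lt _ (fun i j => by ring) (fun i => by ring)]
  congr 1
  exact sum_congr rfl fun p _ => by ring
end

section
/- Let n ≥ 1 and let A be a real symmetric n×n matrix with eigenvalues κ_1,…,κ_n listed with multiplicity, and define C_{ijkl} := A_{ij}(A²)_{kl} − (A²)_{ij}A_{kl}. Then C = 0 (all entries vanish) if and only if κ_i κ_j (κ_i − κ_j) = 0 for all i, j; equivalently, C = 0 if and only if any two nonzero eigenvalues of A are equal. -/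
open Matrix Finset

/-- If the entries of `A ⊗ B - B ⊗ A` vanish, then so do those of `PAQ ⊗ PBQ - PBQ ⊗ PAQ`. -/
theorem conj_tensor_antisymm_eq_zero {m R : Type*} [Fintype m] [CommRing R]
    {A B : Matrix m m R} (P Q : Matrix m m R)
    (h : ∀ i j k l, A i j * B k l - B i j * A k l = 0) (i j k l : m) :
    (P * A * Q) i j * (P * B * Q) k l - (P * B * Q) i j * (P * A * Q) k l = 0 := by
  have hAB (i j : m) : A i j • B = B i j • A := by
    ext k l
    simpa [sub_eq_zero] using h i j k l
  have hleft (i j : m) : A i j * (P * B * Q) k l = B i j * (P * A * Q) k l := by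
    have := congrArg (fun M => (P * M * Q) k l) (hAB i j)
    simpa using this
  have hsmul : (P * B * Q) k l • A = (P * A * Q) k l • B := by
    ext i j
    simpa [mul_comm] using hleft i j
  have := congrArg (fun M => (P * M * Q) i j) hsmul
  simp only [Matrix.mul_smul, Matrix.smul_mul, Matrix.smul_apply, smul_eq_mul] at this
  linear_combination this

/-- The entries of `A ⊗ A² - A² ⊗ A` vanish if and only if the nonzero eigenvalues of the
orthogonally diagonalized matrix `A` coincide. -/
theorem tensor_sq_antisymm_eq_zero_iff {m R : Type*} [Fintype m] [DecidableEq m]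
    [CommRing R] [IsDomain R] {A U : Matrix m m R} {κ : m → R}
    (hU : U * Uᵀ = 1) (hA : A = U * Matrix.diagonal κ * Uᵀ) :
    (∀ i j k l, A i j * (A * A) k l - (A * A) i j * A k l = 0) ↔
      ∀ i j, κ i ≠ 0 → κ j ≠ 0 → κ i = κ j := by
  have hU' : Uᵀ * U = 1 := mul_eq_one_comm.mp hU
  have hAA : A * A = U * (Matrix.diagonal κ * Matrix.diagonal κ) * Uᵀ := by
    calc A * A = U * Matrix.diagonal κ * (Uᵀ * U) * Matrix.diagonal κ * Uᵀ := by
          simp only [hA, Matrix.mul_assoc]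
      _ = _ := by simp only [hU', Matrix.mul_one, Matrix.mul_assoc]
  constructor
  · intro h i j hi hj
    have hconj (D : Matrix m m R) : Uᵀ * (U * D * Uᵀ) * U = D := by
      calc Uᵀ * (U * D * Uᵀ) * U = (Uᵀ * U) * D * (Uᵀ * U) := by
            simp only [Matrix.mul_assoc]
        _ = D := by simp [hU']
    have hD := conj_tensor_antisymm_eq_zero Uᵀ U h i i j j
    rw [hAA, hA, hconj, hconj] at hD
    simp only [Matrix.diagonal_mul_diagonal, Matrix.diagonal_apply_eq] at hD
    have : κ i * κ j * (κ j - κ i) = 0 := by linear_combination hD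
    exact (sub_eq_zero.mp ((mul_eq_zero.mp this).resolve_left (mul_ne_zero hi hj))).symm
  · intro h
    obtain ⟨c, hc⟩ : ∃ c, ∀ i, κ i * κ i = c * κ i := by
      by_cases h0 : ∃ i, κ i ≠ 0
      · obtain ⟨i, hi⟩ := h0
        refine ⟨κ i, fun j => ?_⟩
        by_cases hj : κ j = 0
        · simp [hj]
        · rw [h i j hi hj]
      · push Not at h0
        exact ⟨0, fun i => by simp [h0 i]⟩
    have hsq : A * A = c • A := by
      have hD : Matrix.diagonal κ * Matrix.diagonal κ = c • Matrix.diagonal κ := by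
        rw [Matrix.diagonal_mul_diagonal, ← Matrix.diagonal_smul]
        exact congrArg _ (funext hc)
      rw [hAA, hD, Matrix.mul_smul, Matrix.smul_mul, ← hA]
    intro i j k l
    simp only [hsq, Matrix.smul_apply, smul_eq_mul]
    ring

/-- vanishing of `C = A⊗A² − A²⊗A`: for a real symmetric matrix `A`
with eigenvalues `κ` (listed with multiplicity, i.e. `A = U (diag κ) Uᵀ` for an
orthogonal `U`), the array `C_{ijkl} = A_{ij}(A²)_{kl} − (A²)_{ij}A_{kl}` vanishes
identically if and only if `κ_i κ_j (κ_i − κ_j) = 0` for all `i, j`; equivalently, iff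
any two nonzero eigenvalues of `A` are equal. -/
theorem stmt_3 (n : ℕ) (hn : 1 ≤ n)
    (A U : Matrix (Fin n) (Fin n) ℝ) (κ : Fin n → ℝ)
    (hU : U * Uᵀ = 1)
    (hA : A = U * Matrix.diagonal κ * Uᵀ) :
    ((∀ i j k l, A i j * (A * A) k l - (A * A) i j * A k l = 0) ↔
      ∀ i j, κ i * κ j * (κ i - κ j) = 0) ∧
    ((∀ i j k l, A i j * (A * A) k l - (A * A) i j * A k l = 0) ↔
      ∀ i j, κ i ≠ 0 → κ j ≠ 0 → κ i = κ j) := by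
  have h := tensor_sq_antisymm_eq_zero_iff hU hA
  refine ⟨h.trans (forall₂_congr fun i j => ?_), h⟩
  rw [mul_eq_zero, mul_eq_zero, sub_eq_zero]
  tauto
end

section
/- Let n ≥ 2 and let K ⊆ Sym(n,ℝ) be a closed cone, invariant under conjugation by orthogonal matrices, such that every W ∈ K with W ≠ 0 has tr W > 0 and no element of K is a cylindrical point. Then there exists a constant γ > 0 such that for every W ∈ K one has ∑_{i,j,k,l=1}^n (W_{ij}(W²)_{kl} − (W²)_{ij}W_{kl})² ≥ γ · ‖W‖_F² · (tr W)⁴. -/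
open Matrix Finset

/-- A *cylindrical point* is a real symmetric matrix which, for some `m ∈ {0,…,n−1}`,
has eigenvalue `0` with multiplicity `m` and a positive eigenvalue `a` with
multiplicity `n − m` (and no other eigenvalues). -/
def IsCylindricalPoint {n : ℕ} (W : Matrix (Fin n) (Fin n) ℝ) : Prop :=
  ∃ (U : Matrix (Fin n) (Fin n) ℝ) (m : ℕ) (a : ℝ),
    U * Uᵀ = 1 ∧ m < n ∧ 0 < a ∧
    W = U * Matrix.diagonal (fun i : Fin n => if (i : ℕ) < m then 0 else a) * Uᵀ

/-- A `0`-or-`a` valued function on `Fin n` can be permuted so that all its zeros come first. -/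
lemma exists_perm_zeros_first {n : ℕ} {a : ℝ} (ev : Fin n → ℝ) (h : ∀ i, ev i = 0 ∨ ev i = a)
    (hne : ∃ i, ev i ≠ 0) :
    ∃ (σ : Equiv.Perm (Fin n)) (m : ℕ), m < n ∧
      ∀ i, ev (σ i) = if (i : ℕ) < m then 0 else a := by
  classical
  have hm : Fintype.card {i // ev i = 0} < n := by
    obtain ⟨i, hi⟩ := hne
    simpa using Fintype.card_subtype_lt (p := fun i => ev i = 0) hi
  have hcard : Fintype.card {i : Fin n // (i : ℕ) < Fintype.card {i // ev i = 0}} =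
      Fintype.card {i // ev i = 0} := by
    rw [Fintype.card_subtype, Fin.card_filter_val_lt, min_eq_right hm.le]
  have e := Fintype.equivOfCardEq hcard
  refine ⟨e.extendSubtype, _, hm, fun i => ?_⟩
  split_ifs with hi
  · exact e.extendSubtype_mem i hi
  · exact (h _).resolve_left (e.extendSubtype_not_mem i hi)

/-- A nonzero symmetric matrix with `W² = a W`, `a > 0`, is a cylindrical point. -/
lemma isCylindricalPoint_of_mul_self {n : ℕ} {W : Matrix (Fin n) (Fin n) ℝ} (hW : W.IsSymm)
    (h0 : W ≠ 0) {a : ℝ} (ha : 0 < a) (hmul : W * W = a • W) : IsCylindricalPoint W := by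
  have hH : W.IsHermitian := by
    rw [IsHermitian, conjTranspose_eq_transpose_of_trivial, hW]
  set V : Matrix (Fin n) (Fin n) ℝ := hH.eigenvectorUnitary.val
  have hVV : Vᵀ * V = 1 := by
    simpa [star_eq_conjTranspose] using Unitary.coe_star_mul_self hH.eigenvectorUnitary
  have hVV' : V * Vᵀ = 1 := mul_eq_one_comm.mp hVV
  have hspec : W = V * diagonal hH.eigenvalues * Vᵀ := by
    have := hH.spectral_theorem
    simpa [Unitary.conjStarAlgAut_apply, star_eq_conjTranspose, Function.comp_def] using this
  have hD : diagonal hH.eigenvalues = Vᵀ * W * V := by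
    conv_rhs => rw [hspec]
    rw [← Matrix.mul_assoc, ← Matrix.mul_assoc, hVV, Matrix.one_mul, Matrix.mul_assoc, hVV,
      Matrix.mul_one]
  have hDD : diagonal hH.eigenvalues * diagonal hH.eigenvalues =
      a • diagonal hH.eigenvalues := by
    calc diagonal hH.eigenvalues * diagonal hH.eigenvalues
        = Vᵀ * W * (V * Vᵀ) * W * V := by rw [hD]; simp only [Matrix.mul_assoc]
      _ = Vᵀ * (W * W) * V := by rw [hVV', Matrix.mul_one]; simp only [Matrix.mul_assoc]
      _ = a • diagonal hH.eigenvalues := by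
        rw [hmul, hD, Matrix.mul_smul, Matrix.smul_mul]
  have hev : ∀ i, hH.eigenvalues i = 0 ∨ hH.eigenvalues i = a := by
    intro i
    have := congrFun (congrFun hDD i) i
    simp only [diagonal_mul_diagonal, diagonal_apply_eq, Matrix.smul_apply, smul_eq_mul] at this
    rcases eq_or_ne (hH.eigenvalues i) 0 with h | h
    · exact Or.inl h
    · exact Or.inr (mul_right_cancel₀ h this)
  have hne : ∃ i, hH.eigenvalues i ≠ 0 := by
    by_contra! hall
    apply h0
    rw [hspec, funext hall]
    simp
  obtain ⟨σ, m, hm, hσ⟩ := exists_perm_zeros_first _ hev hne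
  refine ⟨V.submatrix id σ, m, a, ?_, hm, ha, ?_⟩
  · rw [transpose_submatrix, submatrix_mul_equiv, hVV', submatrix_id_id]
  · have : diagonal (fun i : Fin n => if (i : ℕ) < m then 0 else a) =
        (diagonal hH.eigenvalues).submatrix σ σ := by
      rw [submatrix_diagonal_equiv]
      exact congrArg diagonal (funext fun i => (hσ i).symm)
    rw [this, transpose_submatrix, submatrix_mul_equiv, submatrix_mul_equiv, submatrix_id_id]
    exact hspec

/-- If `W ⊗ W² = W² ⊗ W` and `W` is symmetric of positive trace, then `W` is cylindrical. -/
lemma isCylindricalPoint_of_tensor_comm {n : ℕ} {W : Matrix (Fin n) (Fin n) ℝ}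
    (hW : W.IsSymm) (htr : 0 < W.trace)
    (hC : ∀ i j k l, W i j * (W * W) k l = (W * W) i j * W k l) : IsCylindricalPoint W := by
  have h0 : W ≠ 0 := by
    rintro rfl
    simp at htr
  have htr2 : 0 < (W * W).trace := by
    have hnonneg : 0 ≤ (W * W).trace := by
      simp only [trace, diag_apply, mul_apply]
      refine sum_nonneg fun i _ => sum_nonneg fun j _ => ?_
      rw [hW.apply i j]
      exact mul_self_nonneg _
    refine hnonneg.lt_of_ne fun h => h0 ?_
    have : (Wᴴ * W).trace = 0 := by
      rw [conjTranspose_eq_transpose_of_trivial, hW.eq, ← h]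
    exact trace_conjTranspose_mul_self_eq_zero_iff.mp this
  refine isCylindricalPoint_of_mul_self hW h0 (div_pos htr2 htr) ?_
  ext k l
  have hsum : W.trace * (W * W) k l = (W * W).trace * W k l := by
    simp only [trace, diag_apply, sum_mul]
    exact sum_congr rfl fun i _ => hC i i k l
  rw [Matrix.smul_apply, smul_eq_mul]
  field_simp
  linarith

/-- the estimate `|C|² ≥ γ |A|² H⁴` underlying Proposition 2.4:
for a closed `O(n)`-invariant cone `K` of symmetric matrices, with positive trace away
from `0` and containing no cylindrical points, there is `γ > 0` with
`∑ (W_{ij}(W²)_{kl} − (W²)_{ij}W_{kl})² ≥ γ ‖W‖_F² (tr W)⁴` for all `W ∈ K`. -/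
theorem stmt_4 (n : ℕ) (hn : 2 ≤ n)
    (K : Set (Matrix (Fin n) (Fin n) ℝ))
    (hsym : ∀ W ∈ K, W.IsSymm)
    (hclosed : IsClosed K)
    (hcone : ∀ (c : ℝ), 0 < c → ∀ W ∈ K, c • W ∈ K)
    (hOn : ∀ U : Matrix (Fin n) (Fin n) ℝ, U * Uᵀ = 1 → ∀ W ∈ K, Uᵀ * W * U ∈ K)
    (htrace : ∀ W ∈ K, W ≠ 0 → 0 < W.trace)
    (hcyl : ∀ W ∈ K, ¬ IsCylindricalPoint W) :
    ∃ γ : ℝ, 0 < γ ∧ ∀ W ∈ K,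
      γ * ((∑ i, ∑ j, (W i j) ^ 2) * (W.trace) ^ 4) ≤
        ∑ i, ∑ j, ∑ k, ∑ l, (W i j * (W * W) k l - (W * W) i j * W k l) ^ 2 := by
  set f : Matrix (Fin n) (Fin n) ℝ → ℝ := fun W =>
    ∑ i, ∑ j, ∑ k, ∑ l, (W i j * (W * W) k l - (W * W) i j * W k l) ^ 2 with hf
  set q : Matrix (Fin n) (Fin n) ℝ → ℝ := fun W => ∑ i, ∑ j, (W i j) ^ 2 with hq
  have hfc : Continuous f := by fun_prop
  have hqc : Continuous q := by fun_prop
  have htc : Continuous fun W : Matrix (Fin n) (Fin n) ℝ => W.trace := by fun_prop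
  have hf_smul (c : ℝ) (W) : f (c • W) = c ^ 6 * f W := by
    simp only [hf, Matrix.smul_mul, Matrix.mul_smul, Matrix.smul_apply, smul_eq_mul, mul_sum]
    refine sum_congr rfl fun i _ => sum_congr rfl fun j _ => sum_congr rfl fun k _ =>
      sum_congr rfl fun l _ => ?_
    ring
  have hq_smul (c : ℝ) (W) : q (c • W) = c ^ 2 * q W := by
    simp only [hq, Matrix.smul_apply, smul_eq_mul, mul_sum, mul_pow]
  have hq_entry (W) (i j) : W i j ^ 2 ≤ q W :=
    (single_le_sum (f := fun j => W i j ^ 2) (fun _ _ => sq_nonneg _) (mem_univ j)).trans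
      (single_le_sum (f := fun i => ∑ j, W i j ^ 2)
        (fun _ _ => sum_nonneg fun _ _ => sq_nonneg _) (mem_univ i))
  have hq_pos (W) (hW : W ≠ 0) : 0 < q W := by
    obtain ⟨i, j, hij⟩ : ∃ i j, W i j ≠ 0 := by
      by_contra! h
      exact hW (Matrix.ext h)
    exact (pow_pos (abs_pos.mpr hij) 2).trans_le (by simpa using hq_entry W i j)
  have hf_pos (W) (hWK : W ∈ K) (hW : W ≠ 0) : 0 < f W := by
    have hnonneg (i j k l) : 0 ≤ (W i j * (W * W) k l - (W * W) i j * W k l) ^ 2 := sq_nonneg _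
    refine lt_of_le_of_ne (sum_nonneg fun i _ => sum_nonneg fun j _ => sum_nonneg fun k _ =>
      sum_nonneg fun l _ => hnonneg i j k l) fun h => hcyl W hWK ?_
    refine isCylindricalPoint_of_tensor_comm (hsym W hWK) (htrace W hWK hW)
      fun i j k l => ?_
    have h1 := (sum_eq_zero_iff_of_nonneg fun i _ => sum_nonneg fun j _ => sum_nonneg fun k _ =>
      sum_nonneg fun l _ => hnonneg i j k l).mp h.symm i (mem_univ i)
    have h2 := (sum_eq_zero_iff_of_nonneg fun j _ => sum_nonneg fun k _ =>
      sum_nonneg fun l _ => hnonneg i j k l).mp h1 j (mem_univ j)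
    have h3 := (sum_eq_zero_iff_of_nonneg fun k _ =>
      sum_nonneg fun l _ => hnonneg i j k l).mp h2 k (mem_univ k)
    have h4 := (sum_eq_zero_iff_of_nonneg fun l _ => hnonneg i j k l).mp h3 l (mem_univ l)
    exact sub_eq_zero.mp (pow_eq_zero_iff two_ne_zero |>.mp h4)
  have hS : IsCompact (K ∩ {W | q W = 1}) := by
    have hbox : IsCompact (Set.univ.pi fun _ => Set.univ.pi fun _ => Set.Icc (-1) 1 :
        Set (Fin n → Fin n → ℝ)) :=
      isCompact_univ_pi fun _ => isCompact_univ_pi fun _ => isCompact_Icc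
    refine hbox.of_isClosed_subset (hclosed.inter (isClosed_eq hqc continuous_const)) ?_
    rintro W ⟨-, hW⟩ i - j -
    have hle := hq_entry W i j
    rw [show q W = 1 from hW] at hle
    exact abs_le.mp ((sq_le_one_iff_abs_le_one _).mp hle)
  have hS_ne (W) (hW : W ∈ K ∩ {W | q W = 1}) : W ≠ 0 := by
    rintro rfl
    simpa [hq] using hW.2
  have hnormalize (W) (hWK : W ∈ K) (hW : W ≠ 0) :
      ∃ c : ℝ, 0 < c ∧ c • W ∈ K ∩ {W | q W = 1} := by
    have hpos := hq_pos W hW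
    refine ⟨(√(q W))⁻¹, by positivity, hcone _ (by positivity) W hWK, ?_⟩
    rw [Set.mem_ofPred_eq, hq_smul, inv_pow, Real.sq_sqrt hpos.le, inv_mul_cancel₀ hpos.ne']
  obtain ⟨γ, hγ, hmin⟩ : ∃ γ : ℝ, 0 < γ ∧
      ∀ W ∈ K ∩ {W | q W = 1}, γ * (q W * W.trace ^ 4) ≤ f W := by
    have hgpos (W) (hW : W ∈ K ∩ {W | q W = 1}) : 0 < q W * W.trace ^ 4 :=
      mul_pos (hq_pos W (hS_ne W hW)) (pow_pos (htrace W hW.1 (hS_ne W hW)) 4)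
    obtain ⟨γ, hγ, hle⟩ := hS.exists_forall_le' (f := fun W => f W / (q W * W.trace ^ 4)) (a := 0)
      (hfc.continuousOn.div (hqc.mul (htc.pow 4)).continuousOn fun W hW => (hgpos W hW).ne')
      fun W hW => div_pos (hf_pos W hW.1 (hS_ne W hW)) (hgpos W hW)
    exact ⟨γ, hγ, fun W hW => (le_div_iff₀ (hgpos W hW)).mp (hle W hW)⟩
  refine ⟨γ, hγ, fun W hWK => ?_⟩
  change γ * (q W * W.trace ^ 4) ≤ f W
  rcases eq_or_ne W 0 with rfl | hW
  · simp [hf, hq]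
  · obtain ⟨c, hc, hcW⟩ := hnormalize W hWK hW
    have hle := hmin _ hcW
    rw [hq_smul, hf_smul, trace_smul, smul_eq_mul] at hle
    refine le_of_mul_le_mul_left ?_ (pow_pos hc 6)
    linarith
end

section
/- Let n ≥ 1 be an integer and let β, C, τ₀ be real numbers with β > 0, nβ < 1, C > 0 and τ₀ ≤ 0. Let ψ : ℝ → ℝ be continuous with ψ(t) > 0 for all t and with ∫_s^0 ψ(t) dt ≤ C(1−s)^{n+1} for all s ≤ 0. Then there is no differentiable function φ : ℝ → ℝ such that φ(t) > 0 and φ'(t) ≤ −φ(t)^{1+β} ψ(t)^{−β} for all t ≤ τ₀. -/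
open Set Filter MeasureTheory

/-- Tangent line inequality for the convex function `x ↦ x ^ (-β)` at `M`. -/
theorem rpow_neg_tangent_le {β M x : ℝ} (hβ : 0 < β) (hM : 0 < M) (hx : 0 < x) :
    M ^ (-β) * (1 + β - β * (x / M)) ≤ x ^ (-β) := by
  have hy : 0 < x / M := div_pos hx hM
  have h1 : 1 + β - β * (x / M) ≤ (x / M) ^ (-β) := by
    rw [Real.rpow_def_of_pos hy]
    have h2 := Real.add_one_le_exp (Real.log (x / M) * -β)
    have h3 := mul_le_mul_of_nonneg_left (Real.log_le_sub_one_of_pos hy) hβ.le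
    linarith
  calc M ^ (-β) * (1 + β - β * (x / M)) ≤ M ^ (-β) * (x / M) ^ (-β) := by gcongr
    _ = x ^ (-β) := by
      rw [← Real.mul_rpow hM.le hy.le, mul_div_cancel₀ _ hM.ne']

/-- Integrated form of `φ' ≤ -φ ^ (1 + β) * ψ ^ (-β)`, with `ψ ^ (-β)` bounded below by its
tangent line at `M`. -/
theorem rpow_neg_lower_bound {β τ s M : ℝ} {φ ψ : ℝ → ℝ} (hβ : 0 < β) (hM : 0 < M)
    (hs : s ≤ τ) (hψc : Continuous ψ) (hψpos : ∀ t, 0 < ψ t) (hφ : Differentiable ℝ φ)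
    (h : ∀ t ≤ τ, 0 < φ t ∧ deriv φ t ≤ -(φ t ^ (1 + β) * ψ t ^ (-β))) :
    β * M ^ (-β) * ((1 + β) * (τ - s) - β * (∫ t in s..τ, ψ t) / M) ≤ φ τ ^ (-β) := by
  have hd : ∀ t ∈ Iic τ, HasDerivAt
      (fun t => φ t ^ (-β) - β * M ^ (-β) * ((1 + β) * t - β * (∫ r in s..t, ψ r) / M))
      (deriv φ t * (-β) * φ t ^ (-β - 1)
        - β * M ^ (-β) * ((1 + β) * 1 - β * ψ t / M)) t := by
    intro t ht
    have hI : HasDerivAt (fun t => ∫ r in s..t, ψ r) (ψ t) t :=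
      hψc.integral_hasStrictDerivAt s t |>.hasDerivAt
    exact ((hφ t).hasDerivAt.rpow_const (Or.inl (h t ht).1.ne')).sub
      ((((hasDerivAt_id t).const_mul (1 + β)).sub ((hI.const_mul β).div_const M)).const_mul _)
  have hmono := monotoneOn_of_deriv_nonneg (convex_Iic τ)
    (fun t ht => (hd t ht).continuousAt.continuousWithinAt)
    (fun t ht => (hd t (interior_subset ht)).differentiableAt.differentiableWithinAt)
    (fun t ht => by
      have ht' := interior_subset ht
      rw [(hd t ht').deriv]
      obtain ⟨hp, hle⟩ := h t ht'
      have hT := rpow_neg_tangent_le hβ hM (hψpos t)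
      have hq : 0 < φ t ^ (-β - 1) := Real.rpow_pos_of_pos hp _
      have hone : φ t ^ (1 + β) * φ t ^ (-β - 1) = 1 := by
        rw [← Real.rpow_add hp]; ring_nf; exact Real.rpow_zero _
      have h1 : ψ t ^ (-β) ≤ -deriv φ t * φ t ^ (-β - 1) := by
        calc ψ t ^ (-β) = φ t ^ (1 + β) * φ t ^ (-β - 1) * ψ t ^ (-β) := by
              rw [hone, one_mul]
          _ = φ t ^ (1 + β) * ψ t ^ (-β) * φ t ^ (-β - 1) := by ring
          _ ≤ _ := by gcongr; linarith
      have h2 := mul_le_mul_of_nonneg_left (hT.trans h1) hβ.le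
      rw [← mul_div_assoc] at h2
      linarith)
  have hle := hmono (mem_Iic.2 hs) (mem_Iic.2 le_rfl) hs
  simp only [intervalIntegral.integral_same] at hle
  have hsp : 0 < φ s ^ (-β) := Real.rpow_pos_of_pos (h s hs).1 _
  have e : ∀ I : ℝ, β * M ^ (-β) * ((1 + β) * (τ - s) - β * I / M)
      = β * M ^ (-β) * ((1 + β) * τ - β * I / M)
        - β * M ^ (-β) * ((1 + β) * s - β * 0 / M) := by intro I; ring
  rw [e]
  linarith


/-- core ODE-comparison argument in the proof of Theorem 1.4: if
`β > 0`, `nβ < 1`, `C > 0`, `τ₀ ≤ 0`, and `ψ` is a continuous positive function with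
`∫_s^0 ψ ≤ C(1−s)^{n+1}` for all `s ≤ 0`, then there is no differentiable `φ : ℝ → ℝ`
which is positive and satisfies `φ' ≤ −φ^{1+β} ψ^{−β}` on `(−∞, τ₀]`. -/
theorem stmt_9 (n : ℕ) (hn : 1 ≤ n) (β C τ₀ : ℝ)
    (hβ : 0 < β) (hnβ : (n : ℝ) * β < 1) (hC : 0 < C) (hτ₀ : τ₀ ≤ 0)
    (ψ : ℝ → ℝ) (hψc : Continuous ψ) (hψpos : ∀ t, 0 < ψ t)
    (hψint : ∀ s : ℝ, s ≤ 0 → (∫ t in s..0, ψ t) ≤ C * (1 - s) ^ (n + 1)) :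
    ¬ ∃ φ : ℝ → ℝ, Differentiable ℝ φ ∧
      ∀ t : ℝ, t ≤ τ₀ →
        0 < φ t ∧ deriv φ t ≤ -(φ t ^ (1 + β) * ψ t ^ (-β)) := by
  rintro ⟨φ, hφ, h⟩
  have hlim : Tendsto (fun u : ℝ => β * (2 * C) ^ (-β) / 2 * u ^ (1 - n * β)) atTop atTop :=
    (tendsto_rpow_atTop (by linarith)).const_mul_atTop (by positivity)
  obtain ⟨u, hu, hu2⟩ := ((hlim.eventually_gt_atTop (φ τ₀ ^ (-β))).and
    (eventually_ge_atTop (2 * (1 - τ₀)))).exists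
  have hu0 : 0 < u := by linarith
  have hM : 0 < 2 * C * u ^ n := by positivity
  have hkey := rpow_neg_lower_bound hβ hM (s := 1 - u) (by linarith) hψc hψpos hφ h
  have hI : (∫ t in (1 - u)..τ₀, ψ t) ≤ C * u ^ (n + 1) := by
    have h1 := hψint (1 - u) (by linarith)
    rw [sub_sub_cancel] at h1
    have h2 := intervalIntegral.integral_add_adjacent_intervals
      (hψc.intervalIntegrable (μ := volume) (1 - u) τ₀) (hψc.intervalIntegrable τ₀ 0)
    have h3 : 0 ≤ ∫ t in τ₀..0, ψ t :=
      intervalIntegral.integral_nonneg hτ₀ fun t _ => (hψpos t).le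
    linarith
  have hIM : β * (∫ t in (1 - u)..τ₀, ψ t) / (2 * C * u ^ n) ≤ β * (u / 2) := by
    rw [div_le_iff₀ hM]
    calc _ ≤ β * (C * u ^ (n + 1)) := by gcongr
      _ = _ := by ring
  have hlin : u / 2 ≤ (1 + β) * (τ₀ - (1 - u))
      - β * (∫ t in (1 - u)..τ₀, ψ t) / (2 * C * u ^ n) := by
    have hL : u / 2 ≤ τ₀ - (1 - u) := by linarith
    have := mul_le_mul_of_nonneg_left hL hβ.le
    linarith
  have hpow : (2 * C * u ^ n) ^ (-β) * u = (2 * C) ^ (-β) * u ^ (1 - n * β) := by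
    rw [Real.mul_rpow (by positivity) (by positivity), mul_assoc, ← Real.rpow_natCast,
      ← Real.rpow_mul hu0.le, ← Real.rpow_add_one hu0.ne']
    ring_nf
  have hfin : β * (2 * C * u ^ n) ^ (-β) * (u / 2) ≤ φ τ₀ ^ (-β) :=
    le_trans (by gcongr) hkey
  have : β * (2 * C * u ^ n) ^ (-β) * (u / 2)
      = β * (2 * C) ^ (-β) / 2 * u ^ (1 - n * β) := by
    linear_combination β / 2 * hpow
  linarith
end

section
/- Let n ≥ 2 be an integer, let κ ∈ ℝⁿ with κ_n > 0, and let T : {1,…,n}³ → ℝ be a totally symmetric array, not identically zero, such that W_{pq} T_{kij} = W_{ij} T_{kpq} for all indices p,q,k,i,j ∈ {1,…,n}, where W = diag(κ_1,…,κ_n). Then κ_i = 0 for every i ≠ n, and T_{kij} = 0 unless k = i = j = n. -/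
open Matrix

/-- A symmetric array proportional to `diag κ` in its last two indices is supported at `(m, m, m)`,
for any `m` with `κ m ≠ 0`. -/
theorem eq_zero_of_diagonal_mul_eq {ι R : Type*} [DecidableEq ι] [CommRing R] [NoZeroDivisors R]
    {κ : ι → R} {m : ι} (hκ : κ m ≠ 0) {T : ι → ι → ι → R}
    (hT1 : ∀ i j k, T i j k = T j i k)
    (hrel : ∀ p q k i j, diagonal κ p q * T k i j = diagonal κ i j * T k p q)
    (k i j : ι) (h : ¬(k = m ∧ i = m ∧ j = m)) : T k i j = 0 := by
  have offdiag : ∀ k i j, i ≠ j → T k i j = 0 := fun k i j hij => by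
    simpa [diagonal_apply_ne _ hij, hκ] using hrel m m k i j
  by_cases hij : i = j
  · subst hij
    by_cases hki : k = i
    · subst hki
      have hkm : k ≠ m := fun hkm => h ⟨hkm, hkm, hkm⟩
      simpa [hT1 k m m, offdiag m k m hkm, hκ] using hrel m m k k k
    · rw [hT1]
      exact offdiag i k i hki
  · exact offdiag k i j hij

/-- rigidity argument at the heart of Lemma 2.1: if `κ ∈ ℝⁿ` with
`κ_n > 0` and `T` is a totally symmetric, not identically zero, three-index array with
`W_{pq} T_{kij} = W_{ij} T_{kpq}` for all indices, where `W = diag(κ)`, then `κ_i = 0`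
for every `i ≠ n` and `T_{kij} = 0` unless `k = i = j = n`. -/
theorem stmt_14 (n : ℕ) (hn : 2 ≤ n) (κ : Fin n → ℝ)
    (hκ : 0 < κ ⟨n - 1, by omega⟩)
    (T : Fin n → Fin n → Fin n → ℝ)
    (hT1 : ∀ i j k, T i j k = T j i k) (hT2 : ∀ i j k, T i j k = T i k j)
    (hTne : ∃ i j k, T i j k ≠ 0)
    (hrel : ∀ p q k i j, Matrix.diagonal κ p q * T k i j
        = Matrix.diagonal κ i j * T k p q) :
    (∀ i : Fin n, i ≠ ⟨n - 1, by omega⟩ → κ i = 0) ∧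
    (∀ k i j : Fin n,
      ¬(k = (⟨n - 1, by omega⟩ : Fin n) ∧ i = (⟨n - 1, by omega⟩ : Fin n) ∧
          j = (⟨n - 1, by omega⟩ : Fin n)) →
        T k i j = 0) := by
  have hzero := eq_zero_of_diagonal_mul_eq hκ.ne' hT1 hrel
  refine ⟨fun i hi => ?_, hzero⟩
  obtain ⟨a, b, c, habc⟩ := hTne
  obtain ⟨rfl, rfl, rfl⟩ := not_imp_comm.mp (hzero a b c) habc
  have h := hrel i i ⟨n - 1, by omega⟩ ⟨n - 1, by omega⟩ ⟨n - 1, by omega⟩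
  rw [hzero _ i i fun h => hi h.2.1, mul_zero, diagonal_apply_eq] at h
  exact (mul_eq_zero.mp h).resolve_right habc
end
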